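/- Tail bound for down spins beyond the interface: Consider the weighted path model on words α ∈ {0,1}^N with exactly N/2 ones (N even), probability of α proportional to q^{2Σ_k kα_k}, 0<q<1. For L even with L ≤ N and any l ≥ 1, the probability that there are at least l ones among positions (N+L)/2+1,...,N is at most C(q)·q^{l² + Ll}, where C(q) = exp(q^3/(1-q^2))·(1-q^2)^{-0} suitably chosen depending only on q (e.g. C(q) = exp(q^{3}/(1-q^{2}))). -/

import Mathlib

open Finset

/-- Gaussian-binomial-like generating function. -/
noncomputable def GG (p : ℝ) : ℕ → ℕ → ℝ
  | _, 0 => 1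
  | 0, _ + 1 => 0
  | m + 1, k + 1 => p ^ (k + 1) * (GG p m (k + 1) + GG p m k)

lemma GG_nonneg (p : ℝ) (hp : 0 ≤ p) : ∀ m k, 0 ≤ GG p m k
  | m, 0 => by simp [GG]
  | 0, k + 1 => by simp [GG]
  | m + 1, k + 1 => by
    have h1 := GG_nonneg p hp m (k + 1)
    have h2 := GG_nonneg p hp m k
    rw [GG]; positivity

lemma sum_eq_GG (p : ℝ) : ∀ (d a r : ℕ),
    ∑ T ∈ (Finset.Icc (a + 1) (a + d)).powersetCard r, p ^ (∑ x ∈ T, x)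
      = p ^ (r * a) * GG p d r
  | d, a, 0 => by simp [GG]
  | 0, a, r + 1 => by
    have : Finset.Icc (a + 1) (a + 0) = ∅ := by
      apply Finset.Icc_eq_empty; omega
    rw [this]
    rw [Finset.powersetCard_eq_empty.2 (by simp)]
    simp [GG]
  | d + 1, a, r + 1 => by
    have hI : Finset.Icc (a + 1) (a + (d + 1))
        = insert (a + 1) (Finset.Icc (a + 1 + 1) (a + 1 + d)) := by
      ext x; simp only [Finset.mem_Icc, Finset.mem_insert]; omega
    have hn : a + 1 ∉ Finset.Icc (a + 1 + 1) (a + 1 + d) := by simp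
    have h1 := sum_eq_GG p d (a + 1) (r + 1)
    have h2 := sum_eq_GG p d (a + 1) r
    have hmem : ∀ T ∈ (Finset.Icc (a + 1 + 1) (a + 1 + d)).powersetCard r, a + 1 ∉ T := by
      intro T hT h
      exact hn ((Finset.mem_powersetCard.1 hT).1 h)
    rw [hI, Finset.powersetCard_succ_insert hn, Finset.sum_union, h1, Finset.sum_image]
    · have : ∑ T ∈ (Finset.Icc (a + 1 + 1) (a + 1 + d)).powersetCard r,
          p ^ (∑ x ∈ insert (a + 1) T, x) = p ^ (a + 1) * (p ^ (r * (a + 1)) * GG p d r) := by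
        rw [← h2, Finset.mul_sum]
        apply Finset.sum_congr rfl
        intro T hT
        rw [Finset.sum_insert (hmem T hT), pow_add]
      rw [this, GG]; ring
    · intro S hS T hT h
      have := congrArg (fun X => Finset.erase X (a + 1)) h
      simpa [Finset.erase_insert (hmem S hS), Finset.erase_insert (hmem T hT)] using this
    · rw [Finset.disjoint_left]
      intro S hS hS'
      obtain ⟨T, _, rfl⟩ := Finset.mem_image.1 hS'
      exact hn ((Finset.mem_powersetCard.1 hS).1 (Finset.mem_insert_self _ _))

lemma GG_mono (p : ℝ) (hp : 0 ≤ p) {m m' : ℕ} (h : m ≤ m') (k : ℕ) : GG p m k ≤ GG p m' k := by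
  have h1 := sum_eq_GG p m 0 k
  have h2 := sum_eq_GG p m' 0 k
  simp only [mul_zero, pow_zero, one_mul] at h1 h2
  rw [← h1, ← h2]
  apply Finset.sum_le_sum_of_subset_of_nonneg
  · apply Finset.powersetCard_mono
    apply Finset.Icc_subset_Icc <;> omega
  · intros; positivity

/-- triangular numbers -/
def tri : ℕ → ℕ
  | 0 => 0
  | r + 1 => tri r + (r + 1)

lemma two_tri (r : ℕ) : 2 * tri r = r * (r + 1) := by
  induction r with
  | zero => rfl
  | succ r ih => rw [tri, mul_add, ih]; ring

lemma GG_shift (p : ℝ) (hp : 0 ≤ p) (m k r : ℕ) :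
    p ^ (tri r + r * k) * GG p m k ≤ GG p (m + r) (k + r) := by
  induction r with
  | zero => simp [tri]
  | succ r ih =>
    have h : GG p (m + (r + 1)) (k + (r + 1))
      = p ^ (k + r + 1) * (GG p (m + r) (k + r + 1) + GG p (m + r) (k + r)) := by
      rw [← add_assoc, ← add_assoc, GG]
    rw [h]
    have h0 := GG_nonneg p hp (m + r) (k + r + 1)
    calc p ^ (tri (r + 1) + (r + 1) * k) * GG p m k
        = p ^ (k + r + 1) * (p ^ (tri r + r * k) * GG p m k) := by rw [tri]; ring
      _ ≤ _ := by
        apply mul_le_mul_of_nonneg_left _ (by positivity)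
        linarith

lemma amgm (q : ℝ) (hq0 : 0 < q) (hq1 : q < 1) (r : ℕ) :
    (r + 1) * q ^ r * (1 - q ^ 2) ≤ 1 - (q ^ 2) ^ (r + 1) := by
  induction r with
  | zero => simp
  | succ r ih =>
    have h1 : q ^ (r + 1) ≤ 1 := pow_le_one₀ hq0.le hq1.le
    have h2 : q ^ (r + 2) ≤ 1 := pow_le_one₀ hq0.le hq1.le
    have h3 : 0 ≤ (1 - q) * ((1 - q ^ (r + 1)) * (1 - q ^ (r + 2))) :=
      mul_nonneg (by linarith) (mul_nonneg (by linarith) (by linarith))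
    have h4 := mul_le_mul_of_nonneg_left ih hq0.le
    push_cast
    have e : 1 - (q ^ 2) ^ (r + 1 + 1) - ((r : ℝ) + 1 + 1) * q ^ (r + 1) * (1 - q ^ 2)
      = (q * (1 - (q ^ 2) ^ (r + 1)) - q * ((r + 1) * q ^ r * (1 - q ^ 2)))
        + (1 - q) * ((1 - q ^ (r + 1)) * (1 - q ^ (r + 2))) := by ring
    linarith

/-- upper bound for `GG` -/
noncomputable def VV (q : ℝ) (r : ℕ) : ℝ := q ^ (tri r + r) / (r.factorial * (1 - q ^ 2) ^ r)

lemma VV_nonneg (q : ℝ) (hq0 : 0 < q) (hq1 : q < 1) (r : ℕ) : 0 ≤ VV q r := by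
  have : 0 < 1 - q ^ 2 := by nlinarith
  unfold VV; positivity

lemma VV_succ (q : ℝ) (hq0 : 0 < q) (hq1 : q < 1) (r : ℕ) :
    VV q (r + 1) * ((r + 1) * (1 - q ^ 2)) = q ^ (r + 2) * VV q r := by
  have : 0 < 1 - q ^ 2 := by nlinarith
  unfold VV
  rw [Nat.factorial_succ, tri]
  push_cast
  field_simp
  ring

lemma GG_le_VV (q : ℝ) (hq0 : 0 < q) (hq1 : q < 1) : ∀ m k, GG (q ^ 2) m k ≤ VV q k
  | m, 0 => by simp [GG, VV, tri]
  | 0, k + 1 => by simpa [GG] using VV_nonneg q hq0 hq1 (k + 1)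
  | m + 1, k + 1 => by
    have h1 := GG_le_VV q hq0 hq1 m (k + 1)
    have h2 := GG_le_VV q hq0 hq1 m k
    have h3 := VV_succ q hq0 hq1 k
    have h4 := amgm q hq0 hq1 k
    have h5 := VV_nonneg q hq0 hq1 (k + 1)
    have h6 : (q ^ 2) ^ (k + 1) * VV q k ≤ VV q (k + 1) * (1 - (q ^ 2) ^ (k + 1)) := by
      calc (q ^ 2) ^ (k + 1) * VV q k = q ^ k * (q ^ (k + 2) * VV q k) := by ring
        _ = VV q (k + 1) * ((k + 1) * q ^ k * (1 - q ^ 2)) := by rw [← h3]; ring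
        _ ≤ _ := mul_le_mul_of_nonneg_left h4 h5
    rw [GG]
    have h7 : (q ^ 2) ^ (k + 1) * (GG (q ^ 2) m (k + 1) + GG (q ^ 2) m k)
        ≤ (q ^ 2) ^ (k + 1) * (VV q (k + 1) + VV q k) :=
      mul_le_mul_of_nonneg_left (by linarith) (by positivity)
    linarith

/-- Main bound on one slice. -/
lemma slice (q : ℝ) (hq0 : 0 < q) (hq1 : q < 1) (n M r : ℕ) (hr : r + M ≤ n) :
    (q ^ 2) ^ (r * (n + M)) * GG (q ^ 2) (n - M) r * GG (q ^ 2) (n + M) (n - r)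
      ≤ q ^ (2 * M * r + r * (r - 1)) * VV q r * GG (q ^ 2) (2 * n) n := by
  have hp : 0 ≤ q ^ 2 := by positivity
  have h1 := GG_le_VV q hq0 hq1 (n - M) r
  have h2 := GG_shift (q ^ 2) hp (n + M) (n - r) r
  rw [Nat.sub_add_cancel (by omega : r ≤ n)] at h2
  have h3 := GG_mono (q ^ 2) hp (by omega : n + M + r ≤ 2 * n) n
  have hA := GG_nonneg (q ^ 2) hp (n + M) (n - r)
  have hV := VV_nonneg q hq0 hq1 r
  have he : (q ^ 2) ^ (r * (n + M))
      = q ^ (2 * M * r + r * (r - 1)) * (q ^ 2) ^ (tri r + r * (n - r)) := by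
    rw [← pow_mul, ← pow_mul, ← pow_add]
    congr 1
    have := two_tri r
    rw [mul_add 2 (tri r), this]
    obtain ⟨c, rfl⟩ : ∃ c, n = r + c := ⟨n - r, by omega⟩
    rw [Nat.add_sub_cancel_left]
    cases r with
    | zero => simp
    | succ s => simp only [Nat.add_sub_cancel]; ring
  calc _ ≤ (q ^ 2) ^ (r * (n + M)) * VV q r * GG (q ^ 2) (n + M) (n - r) := by gcongr
    _ = q ^ (2 * M * r + r * (r - 1)) * VV q r *
        ((q ^ 2) ^ (tri r + r * (n - r)) * GG (q ^ 2) (n + M) (n - r)) := by rw [he]; ring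
    _ ≤ _ := by
      apply mul_le_mul_of_nonneg_left (h2.trans h3) (by positivity)

lemma term_gt (q : ℝ) (hq0 : 0 < q) (hq1 : q < 1) (M r l : ℕ) (hl : 1 ≤ l) (h : l < r) :
    q ^ (2 * M * r + r * (r - 1)) * VV q r
      ≤ q ^ (l ^ 2 + 2 * M * l) * ((q ^ 3 / (1 - q ^ 2)) ^ r / r.factorial) := by
  have hx : 0 < 1 - q ^ 2 := by nlinarith
  have e1 : q ^ (2 * M * r + r * (r - 1)) * VV q r
    = q ^ (2 * M * r + r * (r - 1) + (tri r + r)) / (r.factorial * (1 - q ^ 2) ^ r) := by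
    unfold VV; rw [pow_add _ _ (tri r + r)]; ring
  have e2 : q ^ (l ^ 2 + 2 * M * l) * ((q ^ 3 / (1 - q ^ 2)) ^ r / r.factorial)
    = q ^ (l ^ 2 + 2 * M * l + 3 * r) / (r.factorial * (1 - q ^ 2) ^ r) := by
    rw [div_pow, ← pow_mul, pow_add _ _ (3 * r)]; field_simp
  rw [e1, e2]
  apply div_le_div_of_nonneg_right _ (by positivity)
  apply pow_le_pow_of_le_one hq0.le hq1.le
  have := two_tri r
  obtain ⟨c, rfl⟩ : ∃ c, r = l + 1 + c := ⟨r - l - 1, by omega⟩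
  obtain ⟨d, rfl⟩ : ∃ d, l = d + 1 := ⟨l - 1, by omega⟩
  have e3 : d + 1 + 1 + c - 1 = d + 1 + c := by omega
  rw [e3]
  have : 0 ≤ M * c := by positivity
  nlinarith [mul_nonneg (Nat.zero_le c) (Nat.zero_le d)]

lemma term_eq (q : ℝ) (hq0 : 0 < q) (hq1 : q < 1) (M s : ℕ) :
    q ^ (2 * M * (s + 1) + (s + 1) * s) * VV q (s + 1)
      ≤ q ^ ((s + 1) ^ 2 + 2 * M * (s + 1)) *
        ((q ^ 3 / (1 - q ^ 2)) ^ (s + 1) / (s + 1).factorial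
          + (q ^ 3 / (1 - q ^ 2)) ^ s / s.factorial) := by
  have hx : 0 < 1 - q ^ 2 := by nlinarith
  have key : q ^ tri (s + 1) ≤ q ^ (3 * s) * (q ^ 3 + (s + 1) * (1 - q ^ 2)) := by
    have k1 : q ≤ q ^ 3 + (1 - q ^ 2) := by
      nlinarith [mul_nonneg (sq_nonneg (1 - q)) (by linarith : 0 ≤ 1 + q)]
    have k2 : 1 ≤ q ^ 3 + 2 * (1 - q ^ 2) := by
      nlinarith [mul_nonneg (by linarith : 0 ≤ 1 - q) (by nlinarith : 0 ≤ 1 + q - q ^ 2)]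
    match s with
    | 0 => simpa [tri] using k1
    | 1 =>
      have := mul_le_mul_of_nonneg_left k2 (by positivity : 0 ≤ q ^ 3)
      norm_num [tri] at this ⊢
      linarith
    | 2 =>
      have := mul_le_mul_of_nonneg_left k2 (by positivity : 0 ≤ q ^ 6)
      have h2 : 0 ≤ q ^ 6 * (1 - q ^ 2) := by positivity
      norm_num [tri] at this ⊢
      linarith
    | 3 =>
      have := mul_le_mul_of_nonneg_left k1 (by positivity : 0 ≤ q ^ 9)
      have h2 : 0 ≤ q ^ 9 * (1 - q ^ 2) := by positivity
      norm_num [tri] at this ⊢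
      linarith
    | t + 4 =>
      have h1 : q ^ tri (t + 4 + 1) ≤ q ^ (3 * (t + 4) + 3) := by
        apply pow_le_pow_of_le_one hq0.le hq1.le
        have := two_tri (t + 4 + 1)
        nlinarith
      have h2 : 0 ≤ q ^ (3 * (t + 4)) * (((t + 4 : ℕ) + 1) * (1 - q ^ 2)) := by positivity
      rw [pow_add] at h1
      linarith
  have e1 : q ^ (2 * M * (s + 1) + (s + 1) * s) * VV q (s + 1)
    = q ^ ((s + 1) ^ 2 + 2 * M * (s + 1)) * (q ^ tri (s + 1)
      / ((s + 1).factorial * (1 - q ^ 2) ^ (s + 1))) := by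
    unfold VV; rw [mul_div_assoc', mul_div_assoc', ← pow_add, ← pow_add]; congr 2; ring
  rw [e1]
  apply mul_le_mul_of_nonneg_left _ (by positivity)
  have e2 : (q ^ 3 / (1 - q ^ 2)) ^ (s + 1) / (s + 1).factorial
          + (q ^ 3 / (1 - q ^ 2)) ^ s / s.factorial
      = q ^ (3 * s) * (q ^ 3 + (s + 1) * (1 - q ^ 2))
        / ((s + 1).factorial * (1 - q ^ 2) ^ (s + 1)) := by
    rw [div_pow, div_pow, ← pow_mul, ← pow_mul, Nat.factorial_succ]
    push_cast
    field_simp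
    ring
  rw [e2]
  exact div_le_div_of_nonneg_right key (by positivity)

lemma terms_sum (q : ℝ) (hq0 : 0 < q) (hq1 : q < 1) (M l m : ℕ) (hl : 1 ≤ l) :
    ∑ r ∈ Finset.Icc l m, q ^ (2 * M * r + r * (r - 1)) * VV q r
      ≤ Real.exp (q ^ 3 / (1 - q ^ 2)) * q ^ (l ^ 2 + 2 * M * l) := by
  have hx : 0 < 1 - q ^ 2 := by nlinarith
  by_cases hm : l ≤ m
  · obtain ⟨s, rfl⟩ : ∃ s, l = s + 1 := ⟨l - 1, by omega⟩
    have hI : Finset.Icc (s + 1) m = insert (s + 1) (Finset.Icc (s + 2) m) := by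
      ext x; simp only [Finset.mem_Icc, Finset.mem_insert]; omega
    have hn : s + 1 ∉ Finset.Icc (s + 2) m := by simp
    have hn2 : s ∉ Finset.Icc (s + 1) m := by simp
    set y := q ^ 3 / (1 - q ^ 2) with hy
    have hy0 : 0 ≤ y := by positivity
    have hexp : ∑ r ∈ insert s (Finset.Icc (s + 1) m), y ^ r / r.factorial ≤ Real.exp y := by
      refine le_trans ?_ (Real.sum_le_exp_of_nonneg hy0 (m + 1))
      apply Finset.sum_le_sum_of_subset_of_nonneg
      · intro x; simp only [Finset.mem_Icc, Finset.mem_insert, Finset.mem_range]; omega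
      · intros; positivity
    rw [Finset.sum_insert hn2, hI, Finset.sum_insert hn] at hexp
    rw [hI, Finset.sum_insert hn]
    have h1 := term_eq q hq0 hq1 M s
    have h2 : ∑ r ∈ Finset.Icc (s + 2) m, q ^ (2 * M * r + r * (r - 1)) * VV q r
        ≤ ∑ r ∈ Finset.Icc (s + 2) m,
          q ^ ((s + 1) ^ 2 + 2 * M * (s + 1)) * (y ^ r / r.factorial) := by
      apply Finset.sum_le_sum
      intro r hr
      exact term_gt q hq0 hq1 M r (s + 1) hl (by have := (Finset.mem_Icc.1 hr).1; omega)
    rw [← Finset.mul_sum] at h2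
    have h3 := mul_le_mul_of_nonneg_left hexp
      (by positivity : 0 ≤ q ^ ((s + 1) ^ 2 + 2 * M * (s + 1)))
    rw [← hy] at h1
    simp only [Nat.add_sub_cancel]
    linarith
  · rw [Finset.Icc_eq_empty hm, Finset.sum_empty]; positivity

lemma decomp (p : ℝ) (n M r : ℕ) (hr : r + M ≤ n) :
    ∑ S ∈ ((Finset.Icc 1 (2 * n)).powersetCard n).filter
        (fun S => (S ∩ Finset.Icc (n + M + 1) (2 * n)).card = r), p ^ (∑ x ∈ S, x)
      = p ^ (r * (n + M)) * GG p (n - M) r * GG p (n + M) (n - r) := by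
  have h1 := sum_eq_GG p (n - M) (n + M) r
  have h2 := sum_eq_GG p (n + M) 0 (n - r)
  rw [show n + M + (n - M) = 2 * n by omega] at h1
  simp only [mul_zero, pow_zero, one_mul, zero_add] at h2
  rw [← h1, ← h2, mul_comm (∑ _ ∈ _, _), Finset.sum_mul_sum, ← Finset.sum_product']
  have hd : Disjoint (Finset.Icc 1 (n + M)) (Finset.Icc (n + M + 1) (2 * n)) := by
    rw [Finset.disjoint_left]; intro x; simp only [Finset.mem_Icc]; omega
  have hu : Finset.Icc 1 (n + M) ∪ Finset.Icc (n + M + 1) (2 * n) = Finset.Icc 1 (2 * n) := by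
    ext x; simp only [Finset.mem_Icc, Finset.mem_union]; omega
  generalize Finset.Icc 1 (n + M) = A at *
  generalize Finset.Icc (n + M + 1) (2 * n) = B at *
  rw [← hu]
  have hS : ∀ S ⊆ A ∪ B, (S ∩ A) ∪ (S ∩ B) = S := by
    intro S h
    rw [← Finset.inter_union_distrib_left]; exact Finset.inter_eq_left.2 h
  have hSd : ∀ S : Finset ℕ, Disjoint (S ∩ A) (S ∩ B) := fun S =>
    hd.mono Finset.inter_subset_right Finset.inter_subset_right
  have hi : ∀ X ⊆ A, ∀ Y ⊆ B, (X ∪ Y) ∩ A = X ∧ (X ∪ Y) ∩ B = Y := by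
    intro X hX Y hY
    rw [Finset.disjoint_left] at hd
    constructor
    · ext x
      simp only [Finset.mem_inter, Finset.mem_union]
      have := @hX x; have := @hY x; have := @hd x; tauto
    · ext x
      simp only [Finset.mem_inter, Finset.mem_union]
      have := @hX x; have := @hY x; have := @hd x; tauto
  refine Finset.sum_nbij' (fun S => (S ∩ A, S ∩ B)) (fun X => X.1 ∪ X.2) ?_ ?_ ?_ ?_ ?_
  · intro S h
    simp only [Finset.mem_filter, Finset.mem_powersetCard, Finset.mem_product] at h ⊢
    obtain ⟨⟨ha, hb⟩, hc⟩ := h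
    have := Finset.card_union_of_disjoint (hSd S)
    rw [hS S ha] at this
    exact ⟨⟨Finset.inter_subset_right, by omega⟩, Finset.inter_subset_right, hc⟩
  · rintro ⟨X, Y⟩ h
    simp only [Finset.mem_filter, Finset.mem_powersetCard, Finset.mem_product] at h ⊢
    obtain ⟨⟨ha, hb⟩, hc, he⟩ := h
    rw [(hi X ha Y hc).2, Finset.card_union_of_disjoint (hd.mono ha hc)]
    exact ⟨⟨Finset.union_subset_union ha hc, by omega⟩, he⟩
  · intro S h
    simp only [Finset.mem_filter, Finset.mem_powersetCard] at h
    exact hS S h.1.1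
  · rintro ⟨X, Y⟩ h
    simp only [Finset.mem_powersetCard, Finset.mem_product] at h
    have := hi X h.1.1 Y h.2.1
    simp [this.1, this.2]
  · intro S h
    simp only [Finset.mem_filter, Finset.mem_powersetCard] at h
    rw [← pow_add, ← Finset.sum_union (hSd S), hS S h.1.1]



/-- Tail bound for down spins beyond the interface: in the canonical ensemble
of words of length `N` with `N/2` ones (encoded as sets `S` of positions of
the ones), the probability of having at least `l` ones among the positions
`(N+L)/2 + 1, …, N` is at most `exp(q³/(1-q²)) q^{l² + L·l}`. -/
theorem stmt17 (q : ℝ) (hq0 : 0 < q) (hq1 : q < 1) (N L l : ℕ)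
    (hN : Even N) (hL : Even L) (hLN : L ≤ N) (hl : 1 ≤ l) :
    (∑ S ∈ ((Finset.Icc 1 N).powersetCard (N / 2)).filter
        (fun S => l ≤ (S ∩ Finset.Icc ((N + L) / 2 + 1) N).card),
      q ^ (2 * ∑ x ∈ S, x)) /
      (∑ S ∈ (Finset.Icc 1 N).powersetCard (N / 2), q ^ (2 * ∑ x ∈ S, x))
    ≤ Real.exp (q ^ 3 / (1 - q ^ 2)) * q ^ (l ^ 2 + L * l) := by

  obtain ⟨n, rfl⟩ := hN
  obtain ⟨M, rfl⟩ := hL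
  have e1 : (n + n) / 2 = n := by omega
  have e2 : (n + n + (M + M)) / 2 = n + M := by omega
  rw [e1, e2, ← two_mul, ← two_mul]
  have hM : M ≤ n := by omega
  simp only [pow_mul q 2 (∑ _ ∈ _, _)]
  have hZ := sum_eq_GG (q ^ 2) (2 * n) 0 n
  simp only [mul_zero, pow_zero, one_mul, zero_add] at hZ
  have hpos : 0 < ∑ S ∈ (Finset.Icc 1 (2 * n)).powersetCard n, (q ^ 2) ^ (∑ x ∈ S, x) := by
    apply Finset.sum_pos
    · intros; positivity
    · rw [Finset.powersetCard_nonempty]; simp; omega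
  rw [div_le_iff₀ hpos, hZ]
  rw [hZ] at hpos
  have hmaps : ∀ S ∈ ((Finset.Icc 1 (2 * n)).powersetCard n).filter
        (fun S => l ≤ (S ∩ Finset.Icc (n + M + 1) (2 * n)).card),
      (S ∩ Finset.Icc (n + M + 1) (2 * n)).card ∈ Finset.Icc l (n - M) := by
    intro S hS
    have h1 := (Finset.mem_filter.1 hS).2
    have h2 := Finset.card_le_card
      (Finset.inter_subset_right : S ∩ Finset.Icc (n + M + 1) (2 * n) ⊆ _)
    rw [Nat.card_Icc] at h2
    rw [Finset.mem_Icc]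
    omega
  rw [← Finset.sum_fiberwise_of_maps_to hmaps]
  refine le_trans ?_ (mul_le_mul_of_nonneg_right
    (terms_sum q hq0 hq1 M l (n - M) hl) hpos.le)
  rw [Finset.sum_mul]
  apply Finset.sum_le_sum
  intro r hr
  rw [Finset.mem_Icc] at hr
  refine le_trans ?_ (slice q hq0 hq1 n M r (by omega))
  rw [← decomp (q ^ 2) n M r (by omega)]
  apply Finset.sum_le_sum_of_subset_of_nonneg
  · intro S hS
    simp only [Finset.mem_filter] at hS ⊢
    exact ⟨hS.1.1, hS.2⟩
  · intros; positivity
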